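/- Let p ≥ 3 be a prime. For a ∈ ℚ_p with ‖a‖_p = 1 define ψ(a) := (1/p)·Σ'_{n∈ℕ} (−1)^n (a^{1−p} − 1)^n / n (a convergent series in ℚ_p, with the n = 0 term zero by the convention 1/0 = 0). Then ψ(a) = 0 if and only if a^{p−1} = 1, i.e. the kernel of ψ on the unit group of ℤ_p is exactly the group of roots of unity in ℤ_p. -/

import Mathlib

theorem Padic.inv_natCast_le_norm {p : ℕ} [Fact (Nat.Prime p)] {n : ℕ} (hn : n ≠ 0) :
    (n : ℝ)⁻¹ ≤ ‖(n : ℚ_[p])‖ := by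
  have hp : 0 < p := (Fact.out : p.Prime).pos
  rw [Padic.norm_eq_zpow_neg_valuation (by exact_mod_cast hn), Padic.valuation_natCast, zpow_neg,
    zpow_natCast]
  refine inv_anti₀ (by positivity) ?_
  exact_mod_cast Nat.le_of_dvd (Nat.pos_of_ne_zero hn) pow_padicValNat_dvd

theorem Padic.norm_le_inv_of_norm_lt_one {p : ℕ} [Fact (Nat.Prime p)] {x : ℚ_[p]} (hx : ‖x‖ < 1) :
    ‖x‖ ≤ (p : ℝ)⁻¹ := by
  have h := (Padic.norm_le_pow_iff_norm_lt_pow_add_one x (-1)).2 (by simpa using hx)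
  simpa using h

theorem Padic.norm_pow_sub_one_sub_one_lt_one {p : ℕ} [Fact (Nat.Prime p)] {a : ℚ_[p]}
    (ha : ‖a‖ = 1) : ‖a ^ (p - 1) - 1‖ < 1 := by
  let u : ℤ_[p] := ⟨a, ha.le⟩
  have hu : IsUnit u := PadicInt.isUnit_iff.2 ha
  have h0 : PadicInt.toZMod u ≠ 0 := (hu.map PadicInt.toZMod).ne_zero
  have h1 : u ^ (p - 1) - 1 ∈ RingHom.ker (PadicInt.toZMod (p := p)) := by
    rw [RingHom.mem_ker, map_sub, map_pow, map_one, ZMod.pow_card_sub_one_eq_one h0, sub_self]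
  rw [PadicInt.ker_toZMod, IsLocalRing.mem_maximalIdeal, PadicInt.mem_nonunits] at h1
  rwa [PadicInt.norm_def, PadicInt.coe_sub, PadicInt.coe_pow, PadicInt.coe_one] at h1

theorem Padic.norm_zpow_one_sub_sub_one_lt_one {p : ℕ} [Fact (Nat.Prime p)] {a : ℚ_[p]}
    (ha : ‖a‖ = 1) : ‖a ^ ((1 : ℤ) - (p : ℤ)) - 1‖ < 1 := by
  have h := Padic.norm_pow_sub_one_sub_one_lt_one (p := p) (a := a⁻¹) (by simp [ha])
  have he : (1 : ℤ) - (p : ℤ) = -((p - 1 : ℕ) : ℤ) := by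
    have := (Fact.out : p.Prime).one_le
    omega
  rwa [he, zpow_neg, zpow_natCast, ← inv_pow]

theorem Padic.summable_logSeries {p : ℕ} [Fact (Nat.Prime p)] {x : ℚ_[p]} (hx : ‖x‖ < 1) :
    Summable fun n : ℕ ↦ (-1) ^ n * x ^ n / (n : ℚ_[p]) := by
  have hs := summable_pow_mul_geometric_of_norm_lt_one (R := ℝ) 1 (r := ‖x‖) (by simpa using hx)
  refine Summable.of_norm_bounded hs fun n ↦ ?_
  rcases eq_or_ne n 0 with rfl | hn
  · simp
  have h := Padic.inv_natCast_le_norm (p := p) hn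
  have hn' : (0 : ℝ) < n := by positivity
  rw [norm_div, norm_mul, norm_pow, norm_neg, norm_one, one_pow, one_mul, norm_pow, pow_one,
    div_eq_inv_mul]
  gcongr
  exact inv_le_of_inv_le₀ hn' h

theorem Padic.norm_logSeries_term_lt {p : ℕ} [Fact (Nat.Prime p)] (hp : 3 ≤ p) {x : ℚ_[p]}
    (hx : ‖x‖ < 1) (hx0 : x ≠ 0) (n : ℕ) :
    ‖(-1) ^ (n + 2) * x ^ (n + 2) / ((n + 2 : ℕ) : ℚ_[p])‖ < ‖x‖ := by
  have hxp := Padic.norm_le_inv_of_norm_lt_one hx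
  have hlt : n + 2 < p ^ (n + 1) :=
    lt_of_lt_of_le (by induction n with | zero => norm_num | succ k ih => rw [pow_succ]; omega)
      (Nat.pow_le_pow_left hp (n + 1))
  have hnorm : ((p : ℝ)⁻¹) ^ (n + 1) < ‖((n + 2 : ℕ) : ℚ_[p])‖ := by
    refine lt_of_lt_of_le ?_ (Padic.inv_natCast_le_norm (by omega))
    rw [inv_pow]
    exact inv_strictAnti₀ (by positivity) (by exact_mod_cast hlt)
  have hpow : ‖x‖ ^ (n + 1) < ‖((n + 2 : ℕ) : ℚ_[p])‖ :=
    (pow_le_pow_left₀ (norm_nonneg x) hxp _).trans_lt hnorm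
  rw [norm_div, norm_mul, norm_pow, norm_neg, norm_one, one_pow, one_mul, norm_pow,
    div_lt_iff₀ ((by positivity : (0 : ℝ) ≤ ‖x‖ ^ (n + 1)).trans_lt hpow), pow_succ' ‖x‖ (n + 1)]
  exact mul_lt_mul_of_pos_left hpow (norm_pos_iff.2 hx0)

theorem Padic.norm_tsum_logSeries {p : ℕ} [Fact (Nat.Prime p)] (hp : 3 ≤ p) {x : ℚ_[p]}
    (hx : ‖x‖ < 1) : ‖∑' n : ℕ, (-1) ^ n * x ^ n / (n : ℚ_[p])‖ = ‖x‖ := by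
  rcases eq_or_ne x 0 with rfl | hx0
  · have h (n : ℕ) : (-1) ^ n * 0 ^ n / (n : ℚ_[p]) = 0 := by
      rcases eq_or_ne n 0 with rfl | hn <;> simp [*]
    simp [h]
  have hpos := norm_pos_iff.2 hx0
  have htail : ‖∑' n : ℕ, (-1) ^ (n + 2) * x ^ (n + 2) / ((n + 2 : ℕ) : ℚ_[p])‖ < ‖-x‖ := by
    have hp1 : (p : ℝ)⁻¹ < 1 := inv_lt_one_of_one_lt₀ (by exact_mod_cast (by omega : 1 < p))
    have hle : ‖∑' n : ℕ, (-1) ^ (n + 2) * x ^ (n + 2) / ((n + 2 : ℕ) : ℚ_[p])‖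
        ≤ (p : ℝ)⁻¹ * ‖x‖ := by
      refine (IsUltrametricDist.norm_tsum_le _).trans (ciSup_le fun n ↦ ?_)
      rw [← div_le_iff₀ hpos, ← norm_div]
      refine Padic.norm_le_inv_of_norm_lt_one ?_
      rw [norm_div, div_lt_one hpos]
      exact Padic.norm_logSeries_term_lt hp hx hx0 n
    rw [norm_neg]
    exact hle.trans_lt (mul_lt_of_lt_one_left hpos hp1)
  have hsum := (Padic.summable_logSeries hx).sum_add_tsum_nat_add 2
  have hhead : ∑ n ∈ Finset.range 2, (-1) ^ n * x ^ n / (n : ℚ_[p]) = -x := by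
    simp [Finset.sum_range_succ]
  rw [← hsum, hhead, IsUltrametricDist.norm_add_eq_max_of_norm_ne_norm htail.ne',
    max_eq_left htail.le, norm_neg]


/-- The kernel of the basic δ-character `ψ(a) = (1/p)·Σ' (−1)ⁿ (a^{1−p} − 1)ⁿ / n`
on the unit group of `ℤ_p` is exactly the group of roots of unity, i.e. for
`‖a‖ = 1` one has `ψ(a) = 0 ↔ a^{p−1} = 1`. -/
theorem stmt_8 (p : ℕ) [Fact (Nat.Prime p)] (hp : 3 ≤ p)
    (ψ : ℚ_[p] → ℚ_[p])
    (hψ : ∀ a : ℚ_[p], ‖a‖ = 1 →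
      ψ a = (1 / (p : ℚ_[p])) *
        ∑' n : ℕ, (-1) ^ n * (a ^ ((1 : ℤ) - (p : ℤ)) - 1) ^ n / (n : ℚ_[p])) :
    ∀ a : ℚ_[p], ‖a‖ = 1 → (ψ a = 0 ↔ a ^ (p - 1) = 1) := by
  intro a ha
  have hp0 : (1 / (p : ℚ_[p])) ≠ 0 := one_div_ne_zero (by exact_mod_cast (by omega : p ≠ 0))
  have he : (1 : ℤ) - (p : ℤ) = -((p - 1 : ℕ) : ℤ) := by omega
  rw [hψ a ha, mul_eq_zero, or_iff_right hp0, ← norm_eq_zero,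
    Padic.norm_tsum_logSeries hp (Padic.norm_zpow_one_sub_sub_one_lt_one ha), norm_eq_zero,
    sub_eq_zero, he, zpow_neg, zpow_natCast, inv_eq_one]
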